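/- Let n ≥ 3, ν > n/2 − 1 and 1 ≤ p, q < ∞. For every holomorphic function F on T_{Λ_n} with ‖F‖_{L^{p,q}_ν} < ∞ and every ε > 0, there exists a holomorphic function G on T_{Λ_n} such that ‖G‖_{L^{p,q}_ν} < ∞, sup_{y ∈ Λ_n} ∫_{ℝ^n} |G(x+iy)|² dx < ∞ (i.e. G belongs to the Hardy space H²(T_{Λ_n})), and ‖F − G‖_{L^{p,q}_ν} < ε. (In other words, H²(T_{Λ_n}) ∩ A^{p,q}_ν is dense in A^{p,q}_ν.) -/

import Mathlib

open MeasureTheory Complex Set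
open scoped ENNReal NNReal

noncomputable section

def lorentzQ (n : ℕ) [NeZero n] (y : Fin n → ℝ) : ℝ :=
  y 0 ^ 2 - ∑ k ∈ Finset.univ.filter (fun k => k ≠ 0), y k ^ 2

def lorentzQC (n : ℕ) [NeZero n] (z : Fin n → ℂ) : ℂ :=
  z 0 ^ 2 - ∑ k ∈ Finset.univ.filter (fun k => k ≠ 0), z k ^ 2

def lightCone (n : ℕ) [NeZero n] : Set (Fin n → ℝ) :=
  {y | 0 < y 0 ∧ 0 < lorentzQ n y}

def tubePt (n : ℕ) (x y : Fin n → ℝ) : Fin n → ℂ :=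
  fun k => (x k : ℂ) + (y k : ℂ) * Complex.I

def inTube (n : ℕ) [NeZero n] (z : Fin n → ℂ) : Prop :=
  (fun k => (z k).im) ∈ lightCone n

def eVec (n : ℕ) [NeZero n] : Fin n → ℝ := fun k => if k = 0 then 1 else 0

def mixedNorm (n : ℕ) [NeZero n] (p q ν : ℝ) (F : (Fin n → ℂ) → ℂ) : ℝ≥0∞ :=
  (∫⁻ y in lightCone n,
      (∫⁻ x : Fin n → ℝ, (‖F (tubePt n x y)‖₊ : ℝ≥0∞) ^ p) ^ (q / p)
        * ENNReal.ofReal (lorentzQ n y ^ (ν - (n : ℝ) / 2))) ^ (1 / q)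

def bergmanIntegrand (n : ℕ) [NeZero n] (ν : ℝ) (F : (Fin n → ℂ) → ℂ) (z : Fin n → ℂ)
    (uv : (Fin n → ℝ) × (Fin n → ℝ)) : ℂ :=
  lorentzQC n (fun k => (z k - ((uv.1 k : ℂ) - (uv.2 k : ℂ) * Complex.I)) / Complex.I)
      ^ (((-(ν + (n : ℝ) / 2) : ℝ)) : ℂ)
    * F (tubePt n uv.1 uv.2)
    * ((lorentzQ n uv.2 ^ (ν - (n : ℝ) / 2) : ℝ) : ℂ)

def bergmanOp (n : ℕ) [NeZero n] (ν : ℝ) (F : (Fin n → ℂ) → ℂ) (z : Fin n → ℂ) : ℂ :=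
  ∫ uv in (univ ×ˢ lightCone n : Set ((Fin n → ℝ) × (Fin n → ℝ))),
    bergmanIntegrand n ν F z uv

def qnu (n : ℕ) (ν : ℝ) : ℝ := (ν + (n : ℝ) / 2 - 1) / ((n : ℝ) / 2 - 1)

def pSharp (p : ℝ) : ℝ := if p ≤ 2 then p else p / (p - 1)

def qtilde (n : ℕ) (ν p : ℝ) : ℝ≥0∞ :=
  if 1 < (n : ℝ) / 2 * (1 - 1 / p) then
    ENNReal.ofReal ((ν + (n : ℝ) / 2 - 1) / ((n : ℝ) / 2 * (1 - 1 / p) - 1))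
  else ∞

/-- The tube domain `T_{Λ_n} = ℝ^n + iΛ_n` as a subset of `ℂ^n`. -/
def tubeSet (n : ℕ) [NeZero n] : Set (Fin n → ℂ) := {z | inTube n z}

open Filter Topology

section Cone

lemma im_tubePt {n : ℕ} (x y : Fin n → ℝ) : (fun k => (tubePt n x y k).im) = y := by
  ext k; simp [tubePt]

lemma continuous_tubePt {n : ℕ} : Continuous fun v : (Fin n → ℝ) × (Fin n → ℝ) => tubePt n v.1 v.2 := by
  unfold tubePt; fun_prop

variable {n : ℕ} [NeZero n]

lemma continuous_lorentzQ : Continuous (lorentzQ n) := by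
  unfold lorentzQ; fun_prop

lemma isOpen_lightCone : IsOpen (lightCone n) :=
  (isOpen_lt continuous_const (continuous_apply 0)).inter
    (isOpen_lt continuous_const continuous_lorentzQ)

lemma isOpen_tubeSet : IsOpen (tubeSet n) :=
  isOpen_lightCone.preimage (f := fun (z : Fin n → ℂ) k => (z k).im) (by fun_prop)

lemma lorentzQ_smul (t : ℝ) (y : Fin n → ℝ) : lorentzQ n (t • y) = t ^ 2 * lorentzQ n y := by
  simp only [lorentzQ, Pi.smul_apply, smul_eq_mul, mul_pow, mul_sub, Finset.mul_sum]

lemma lorentzQ_le_sq (y : Fin n → ℝ) : lorentzQ n y ≤ y 0 ^ 2 :=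
  sub_le_self _ (Finset.sum_nonneg fun _ _ => sq_nonneg _)

lemma abs_lt_of_mem_lightCone {y : Fin n → ℝ} (hy : y ∈ lightCone n) {k : Fin n} (hk : k ≠ 0) :
    |y k| < y 0 := by
  refine abs_lt_of_sq_lt_sq ?_ hy.1.le
  have h1 : y k ^ 2 ≤ ∑ j ∈ Finset.univ.filter (fun j => j ≠ 0), y j ^ 2 :=
    Finset.single_le_sum (f := fun j => y j ^ 2) (fun _ _ => sq_nonneg _)
      (Finset.mem_filter.2 ⟨Finset.mem_univ k, hk⟩)
  have h2 : 0 < lorentzQ n y := hy.2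
  unfold lorentzQ at h2
  linarith

lemma lorentzQ_le_add {y u : Fin n → ℝ} (hy : y ∈ lightCone n) (hu : u ∈ lightCone n) :
    lorentzQ n u ≤ lorentzQ n (y + u) := by
  have hy2 : 0 < lorentzQ n y := hy.2
  have hu2 : 0 < lorentzQ n u := hu.2
  have hy1 := hy.1
  have hu1 := hu.1
  have hsum : lorentzQ n (y + u) = lorentzQ n y + lorentzQ n u + 2 * (y 0 * u 0 -
      ∑ k ∈ Finset.univ.filter (fun k => k ≠ 0), y k * u k) := by
    simp only [lorentzQ, Pi.add_apply, add_sq, Finset.sum_add_distrib, mul_assoc, ← Finset.mul_sum]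
    ring
  have hcs := Finset.sum_mul_sq_le_sq_mul_sq (Finset.univ.filter (fun k : Fin n => k ≠ 0)) y u
  have hle : ∑ k ∈ Finset.univ.filter (fun k => k ≠ 0), y k * u k ≤ y 0 * u 0 := by
    refine (abs_le_of_sq_le_sq' (hcs.trans ?_) (by positivity)).2
    rw [mul_pow]
    unfold lorentzQ at hy2 hu2
    refine mul_le_mul (by linarith) (by linarith)
      (Finset.sum_nonneg fun _ _ => sq_nonneg _) (sq_nonneg _)
  rw [hsum]
  linarith

lemma add_mem_lightCone {y u : Fin n → ℝ} (hy : y ∈ lightCone n) (hu : u ∈ lightCone n) :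
    y + u ∈ lightCone n :=
  ⟨add_pos hy.1 hu.1, lt_of_lt_of_le hu.2 (lorentzQ_le_add hy hu)⟩

lemma eVec_mem_lightCone : eVec n ∈ lightCone n := by
  refine ⟨by simp [eVec], ?_⟩
  simp [lorentzQ, eVec]

lemma smul_mem_lightCone {t : ℝ} (ht : 0 < t) {y : Fin n → ℝ} (hy : y ∈ lightCone n) :
    t • y ∈ lightCone n :=
  ⟨mul_pos ht hy.1, by rw [lorentzQ_smul]; exact mul_pos (by positivity) hy.2⟩

lemma add_smul_eVec_mem_lightCone {t : ℝ} (ht : 0 ≤ t) {y : Fin n → ℝ} (hy : y ∈ lightCone n) :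
    y + t • eVec n ∈ lightCone n := by
  rcases ht.eq_or_lt with rfl | ht
  · simpa using hy
  · exact add_mem_lightCone hy (smul_mem_lightCone ht eVec_mem_lightCone)

lemma exists_sub_smul_eVec_mem_lightCone {y : Fin n → ℝ} (hy : y ∈ lightCone n) :
    ∃ t : ℝ, 0 < t ∧ y - t • eVec n ∈ lightCone n := by
  have hc : Continuous fun t : ℝ => y - t • eVec n := by fun_prop
  have h0 : (0 : ℝ) ∈ (fun t : ℝ => y - t • eVec n) ⁻¹' lightCone n := by simpa using hy
  have hev : ∀ᶠ t : ℝ in 𝓝[Ioi 0] 0, y - t • eVec n ∈ lightCone n :=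
    nhdsWithin_le_nhds ((isOpen_lightCone.preimage hc).mem_nhds h0)
  obtain ⟨t, ht, ht0⟩ := (hev.and self_mem_nhdsWithin).exists
  exact ⟨t, ht0, ht⟩

/-- Points of a small box around `δ e` lie in the cone, with the Lorentz form bounded below. -/
lemma exists_box_subset_lightCone (n : ℕ) [NeZero n] {δ : ℝ} (hδ : 0 < δ) :
    ∃ r : ℝ, 0 < r ∧ r ≤ δ ∧ ∀ v : Fin n → ℝ, (∀ k, |v k| ≤ r) →
      δ • eVec n + v ∈ lightCone n ∧ r ^ 2 ≤ lorentzQ n (δ • eVec n + v) := by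
  have hn : (0 : ℝ) < (n : ℝ) + 2 := by positivity
  refine ⟨δ / (n + 2), by positivity, div_le_self hδ.le (by linarith [n.cast_nonneg (α := ℝ)]), ?_⟩
  set r := δ / ((n : ℝ) + 2) with hr
  have hrp : 0 < r := by positivity
  have hδr : δ = (n + 2) * r := by rw [hr]; field_simp
  intro v hv
  have h0 : (δ • eVec n + v) 0 = δ + v 0 := by simp [eVec]
  have hge : (n + 1) * r ≤ δ + v 0 := by
    have := (abs_le.1 (hv 0)).1
    rw [hδr]; linarith
  have hsum : ∑ k ∈ Finset.univ.filter (fun k : Fin n => k ≠ 0), (δ • eVec n + v) k ^ 2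
      ≤ n * r ^ 2 := by
    calc _ ≤ ∑ k ∈ Finset.univ.filter (fun k : Fin n => k ≠ 0), r ^ 2 := by
          refine Finset.sum_le_sum fun k hk => ?_
          have hk' := (Finset.mem_filter.1 hk).2
          simp only [Pi.add_apply, Pi.smul_apply, eVec, hk', if_false, smul_zero, zero_add]
          exact sq_le_sq' (abs_le.1 (hv k)).1 (abs_le.1 (hv k)).2
      _ ≤ ∑ k : Fin n, r ^ 2 :=
          Finset.sum_le_sum_of_subset_of_nonneg (Finset.filter_subset _ _) fun _ _ _ => sq_nonneg _
      _ = n * r ^ 2 := by simp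
  have hn0 : (0 : ℝ) ≤ n := n.cast_nonneg
  have hsq : ((n + 1) * r) ^ 2 ≤ (δ + v 0) ^ 2 := pow_le_pow_left₀ (by positivity) hge 2
  have hQ : r ^ 2 ≤ lorentzQ n (δ • eVec n + v) := by
    unfold lorentzQ
    rw [h0]
    nlinarith [mul_nonneg hn0 (sq_nonneg r), mul_nonneg (mul_nonneg hn0 hn0) (sq_nonneg r)]
  exact ⟨⟨by rw [h0]; exact lt_of_lt_of_le (by positivity) hge, lt_of_lt_of_le (by positivity) hQ⟩, hQ⟩

lemma tubePt_mem_tubeSet {x y : Fin n → ℝ} : tubePt n x y ∈ tubeSet n ↔ y ∈ lightCone n := by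
  change (fun k => (tubePt n x y k).im) ∈ lightCone n ↔ _
  rw [im_tubePt]

/-- The vector `e`, viewed in `ℂ^n`. -/
def eVecC (n : ℕ) [NeZero n] : Fin n → ℂ := fun k => (eVec n k : ℂ)

lemma tubePt_add_smul_eVecC (x y : Fin n → ℝ) (w : ℂ) :
    tubePt n x y + w • eVecC n = tubePt n (x + w.re • eVec n) (y + w.im • eVec n) := by
  ext k
  apply Complex.ext <;> simp [tubePt, eVecC]

end Cone

section MeanValue

lemma ContinuousOn.measurable_indicator {α β : Type*} [TopologicalSpace α]
    [MeasurableSpace α] [OpensMeasurableSpace α] [TopologicalSpace β] [MeasurableSpace β]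
    [BorelSpace β] [Zero β] {f : α → β} {s : Set α} (hf : ContinuousOn f s)
    (hs : MeasurableSet s) : Measurable (s.indicator f) := by
  classical
  rw [← piecewise_eq_indicator]
  exact hf.measurable_piecewise continuousOn_const hs

lemma measurePreserving_smul_pi {n : ℕ} (a : Circle) :
    MeasurePreserving (fun w : Fin n → ℂ => (a : ℂ) • w) :=
  volume_preserving_pi (fun _ : Fin n => (rotation a).measurePreserving)

/-- On the unit disc, `|g 0|` is at most the mean of `|g|` over the unit circle. -/
lemma enorm_le_lintegral_circle {g : ℂ → ℂ} (hg : DiffContOnCl ℂ g (Metric.ball 0 1)) :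
    ENNReal.ofReal (2 * Real.pi) * ‖g 0‖ₑ ≤
      ∫⁻ θ in Ioc 0 (2 * Real.pi), ‖g (circleMap 0 1 θ)‖ₑ := by
  have hav : Real.circleAverage g 0 1 = g 0 :=
    DiffContOnCl.circleAverage (by simpa using hg)
  have hpi : (0 : ℝ) < 2 * Real.pi := by positivity
  have h1 : ((2 * Real.pi : ℝ) : ℂ) * g 0 = ∫ θ in Ioc 0 (2 * Real.pi), g (circleMap 0 1 θ) := by
    rw [← hav, Real.circleAverage, intervalIntegral.integral_of_le hpi.le, real_smul,
      ← mul_assoc, ← ofReal_mul, mul_inv_cancel₀ hpi.ne', ofReal_one, one_mul]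
  calc ENNReal.ofReal (2 * Real.pi) * ‖g 0‖ₑ = ‖((2 * Real.pi : ℝ) : ℂ) * g 0‖ₑ := by
        rw [enorm_mul, ← ofReal_norm (((2 * Real.pi : ℝ) : ℂ)), norm_real,
          Real.norm_of_nonneg hpi.le]
    _ ≤ _ := by rw [h1]; exact enorm_integral_le_lintegral_enorm _

/-- The sub-mean value property of the modulus of a holomorphic function on a polydisc. -/
lemma enorm_mul_volume_le {n : ℕ} {U : Set (Fin n → ℂ)} (hU : IsOpen U) {F : (Fin n → ℂ) → ℂ}
    (hF : DifferentiableOn ℂ F U) {z : Fin n → ℂ} {r : ℝ} (hr : Metric.closedBall z r ⊆ U) :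
    ‖F z‖ₑ * volume (Metric.closedBall (0 : Fin n → ℂ) r) ≤
      ∫⁻ w in Metric.closedBall z r, ‖F w‖ₑ := by
  set B := Metric.closedBall (0 : Fin n → ℂ) r with hB
  have hBm : MeasurableSet B := Metric.isClosed_closedBall.measurableSet
  have hzm : MeasurableSet (Metric.closedBall z r) := Metric.isClosed_closedBall.measurableSet
  set Φ : (Fin n → ℂ) → ℝ≥0∞ := (Metric.closedBall z r).indicator fun w => ‖F w‖ₑ with hΦ
  have hΦm : Measurable Φ :=
    ContinuousOn.measurable_indicator (hF.continuousOn.mono hr).enorm hzm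
  have hshift : ∀ a : Circle, ∫⁻ w in B, Φ (z + (a : ℂ) • w) = ∫⁻ w, Φ w := by
    intro a
    have h1 : ∫⁻ w in B, Φ (z + (a : ℂ) • w) = ∫⁻ w, Φ (z + (a : ℂ) • w) := by
      rw [← lintegral_indicator hBm]
      congr 1; ext w
      by_cases hw : w ∈ B
      · simp [hw]
      · rw [indicator_of_notMem hw, hΦ, indicator_of_notMem]
        simpa [hB, norm_smul, Circle.norm_coe] using hw
    rw [h1, (measurePreserving_smul_pi a).lintegral_comp (f := fun w => Φ (z + w))
      (by fun_prop), lintegral_add_left_eq_self]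
  have hpt : ∀ w ∈ B, ENNReal.ofReal (2 * Real.pi) * ‖F z‖ₑ ≤
      ∫⁻ θ in Ioc 0 (2 * Real.pi), Φ (z + (circleMap 0 1 θ) • w) := by
    intro w hw
    have hmem : ∀ u : ℂ, ‖u‖ ≤ 1 → z + u • w ∈ Metric.closedBall z r := by
      intro u hu
      simp only [hB, Metric.mem_closedBall, dist_zero_right, dist_self_add_left] at hw ⊢
      rw [norm_smul]
      exact (mul_le_of_le_one_left (norm_nonneg _) hu).trans hw
    have hd : DiffContOnCl ℂ (fun u : ℂ => F (z + u • w)) (Metric.ball 0 1) := by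
      refine DifferentiableOn.diffContOnCl ?_
      rw [closure_ball _ one_ne_zero]
      intro u hu
      have hz : z + u • w ∈ U := hr (hmem u (by simpa using hu))
      have hFd : DifferentiableAt ℂ F (z + u • w) := hF.differentiableAt (hU.mem_nhds hz)
      have hl : DifferentiableAt ℂ (fun u : ℂ => z + u • w) u := by fun_prop
      exact (DifferentiableAt.comp u hFd hl).differentiableWithinAt
    have h := enorm_le_lintegral_circle hd
    simp only [zero_smul, add_zero] at h
    refine h.trans (le_of_eq (lintegral_congr fun θ => ?_))
    rw [hΦ, indicator_of_mem (hmem _ (by simp))]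
  have hpi : ENNReal.ofReal (2 * Real.pi) ≠ 0 := by
    simp [Real.pi_pos]
  have key : ENNReal.ofReal (2 * Real.pi) * (‖F z‖ₑ * volume B) ≤
      ENNReal.ofReal (2 * Real.pi) * ∫⁻ w, Φ w := by
    calc ENNReal.ofReal (2 * Real.pi) * (‖F z‖ₑ * volume B)
        = ∫⁻ _ in B, ENNReal.ofReal (2 * Real.pi) * ‖F z‖ₑ := by
          rw [setLIntegral_const, mul_assoc]
      _ ≤ ∫⁻ w in B, ∫⁻ θ in Ioc 0 (2 * Real.pi), Φ (z + (circleMap 0 1 θ) • w) :=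
          setLIntegral_mono' hBm hpt
      _ = ∫⁻ θ in Ioc 0 (2 * Real.pi), ∫⁻ w in B, Φ (z + (circleMap 0 1 θ) • w) := by
          refine lintegral_lintegral_swap (Measurable.aemeasurable (hΦm.comp ?_))
          have : Continuous fun v : (Fin n → ℂ) × ℝ => z + (circleMap 0 1 v.2) • v.1 := by
            have := continuous_circleMap 0 1
            fun_prop
          exact this.measurable
      _ = ∫⁻ _ in Ioc 0 (2 * Real.pi), ∫⁻ w, Φ w := by
          refine lintegral_congr fun θ => ?_
          rw [← hshift (Circle.exp θ)]
          simp [circleMap, Circle.coe_exp]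
      _ = _ := by rw [setLIntegral_const, Real.volume_Ioc, sub_zero, mul_comm]
  rw [ENNReal.mul_le_mul_iff_right hpi ENNReal.ofReal_ne_top] at key
  rwa [hΦ, lintegral_indicator hzm] at key

/-- Fubini's theorem on `ℂ^n`, in real and imaginary parts. -/
lemma lintegral_eq_lintegral_tubePt {n : ℕ} {f : (Fin n → ℂ) → ℝ≥0∞} (hf : Measurable f) :
    ∫⁻ w, f w = ∫⁻ y : Fin n → ℝ, ∫⁻ x : Fin n → ℝ, f (tubePt n x y) := by
  have h1 : MeasurePreserving (fun (w : Fin n → ℂ) k => measurableEquivRealProd (w k)) :=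
    volume_preserving_pi (fun _ : Fin n => volume_preserving_equiv_real_prod)
  have h2 := (volume_measurePreserving_arrowProdEquivProdArrow ℝ ℝ (Fin n)).comp h1
  have hm : Measurable fun v : (Fin n → ℝ) × (Fin n → ℝ) => f (tubePt n v.1 v.2) :=
    hf.comp continuous_tubePt.measurable
  rw [← lintegral_prod_symm _ hm.aemeasurable, ← Measure.volume_eq_prod, ← h2.lintegral_comp hm]
  refine lintegral_congr fun w => ?_
  congr 1
  ext k
  simp [tubePt, MeasurableEquiv.arrowProdEquivProdArrow, Equiv.arrowProdEquivProdArrow]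

end MeanValue

section PointwiseBound

lemma lintegral_le_rpow_lintegral_rpow {α : Type*} [MeasurableSpace α] {μ : Measure α} {p : ℝ}
    (hp : 1 ≤ p) {f : α → ℝ≥0∞} (hf : AEMeasurable f μ) :
    ∫⁻ a, f a ∂μ ≤ (∫⁻ a, f a ^ p ∂μ) ^ (1 / p) * μ univ ^ (1 - 1 / p) := by
  have hp0 : 0 < p := by linarith
  have h1 : (1 : ℝ≥0∞) ≤ ENNReal.ofReal p := by simpa using ENNReal.ofReal_le_ofReal hp
  have h := eLpNorm_le_eLpNorm_mul_rpow_measure_univ (μ := μ) (f := f) h1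
    hf.aestronglyMeasurable
  rw [eLpNorm_one_eq_lintegral_enorm, eLpNorm_eq_lintegral_rpow_enorm_toReal (by simpa using hp0)
    ENNReal.ofReal_ne_top, ENNReal.toReal_ofReal hp0.le] at h
  simpa using h

lemma one_le_pow_mul_rpow {R Q s : ℝ} {a : ℕ} (hQ : 0 < Q) (hR : 1 ≤ R) (hQR : Q ≤ R)
    (hQR' : Q⁻¹ ≤ R) (ha : |s| ≤ a) : 1 ≤ R ^ a * Q ^ s := by
  have hR0 : 0 < R := by linarith
  have h1 : R ^ (-(a : ℝ)) ≤ Q ^ s := by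
    rcases le_total 0 s with hs | hs
    · calc R ^ (-(a : ℝ)) ≤ R ^ (-s) :=
            Real.rpow_le_rpow_of_exponent_le hR (by linarith [le_abs_self s])
        _ = R⁻¹ ^ s := by rw [Real.inv_rpow hR0.le, Real.rpow_neg hR0.le]
        _ ≤ Q ^ s := Real.rpow_le_rpow (by positivity) (inv_le_of_inv_le₀ hQ hQR') hs
    · calc R ^ (-(a : ℝ)) ≤ R ^ s :=
            Real.rpow_le_rpow_of_exponent_le hR (by linarith [neg_le_abs s])
        _ ≤ Q ^ s := Real.rpow_le_rpow_of_nonpos hQ hQR hs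
  calc 1 = R ^ a * R ^ (-(a : ℝ)) := by
        rw [Real.rpow_neg hR0.le, Real.rpow_natCast, mul_inv_cancel₀ (by positivity)]
    _ ≤ _ := by gcongr

variable {n : ℕ} [NeZero n] {F : (Fin n → ℂ) → ℂ}

lemma continuous_slice (hol : DifferentiableOn ℂ F (tubeSet n)) {y : Fin n → ℝ}
    (hy : y ∈ lightCone n) : Continuous fun x => F (tubePt n x y) :=
  hol.continuousOn.comp_continuous (continuous_tubePt.comp (by fun_prop : Continuous fun x => (x, y)))
    fun _ => tubePt_mem_tubeSet.2 hy

/-- A holomorphic function with finite mixed norm grows at most polynomially in `Im z`, uniformly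
in `Re z`, away from the boundary of the tube. -/
lemma exists_norm_le_mul_pow {p q ν : ℝ} (hp : 1 ≤ p) (hq : 1 ≤ q)
    (hol : DifferentiableOn ℂ F (tubeSet n)) (hfin : mixedNorm n p q ν F < ∞) {δ : ℝ}
    (hδ : 0 < δ) :
    ∃ C : ℝ, 0 ≤ C ∧ ∀ x y : Fin n → ℝ, y ∈ lightCone n →
      ‖F (tubePt n x (y + δ • eVec n))‖ ≤ C * (1 + y 0) ^ (2 * ⌈|ν - (n : ℝ) / 2|⌉₊) := by
  have hp0 : 0 < p := by linarith
  have hq0 : 0 < q := by linarith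
  obtain ⟨r, hr, hrδ, hbox⟩ := exists_box_subset_lightCone n hδ
  set s := ν - (n : ℝ) / 2 with hs
  set H : (Fin n → ℝ) → ℝ≥0∞ := fun y => ∫⁻ x : Fin n → ℝ, (‖F (tubePt n x y)‖₊ : ℝ≥0∞) ^ p with hH
  set J := ∫⁻ y in lightCone n, H y ^ (q / p) * ENNReal.ofReal (lorentzQ n y ^ s) with hJ
  have hJfin : J < ∞ := by
    unfold mixedNorm at hfin
    exact (ENNReal.rpow_lt_top_iff_of_pos (by positivity)).1 hfin
  set a := ⌈|s|⌉₊ with ha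
  set K : ℝ := (1 + 2 * δ) ^ 2 * (1 + (r ^ 2)⁻¹) with hK
  have hKpos : 0 < K := by positivity
  set V := volume (Metric.closedBall (0 : Fin n → ℝ) r) with hV
  have hVtop : V ≠ ∞ := measure_closedBall_lt_top.ne
  set V₂ := volume (Metric.closedBall (0 : Fin n → ℂ) r) with hV₂
  have hV₂top : V₂ ≠ ∞ := measure_closedBall_lt_top.ne
  have hV₂0 : V₂ ≠ 0 := (Metric.measure_closedBall_pos _ _ hr).ne'
  set c : ℝ≥0∞ := V ^ (1 - 1 / p) * (V + ENNReal.ofReal (K ^ a) * J) / V₂ with hc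
  have hctop : c ≠ ∞ := by
    have h1 : 0 ≤ 1 - 1 / p := by
      rw [sub_nonneg, div_le_one hp0]; exact hp
    refine ENNReal.div_ne_top (ENNReal.mul_ne_top (ENNReal.rpow_ne_top_of_nonneg h1 hVtop) ?_) hV₂0
    exact ENNReal.add_ne_top.2 ⟨hVtop, ENNReal.mul_ne_top ENNReal.ofReal_ne_top hJfin.ne⟩
  refine ⟨c.toReal, ENNReal.toReal_nonneg, fun x y hy => ?_⟩
  have hy0 : 0 < y 0 := hy.1
  set R : ℝ := K * (1 + y 0) ^ 2 with hR
  set Bx := Metric.closedBall x r with hBx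
  set By := Metric.closedBall (y + δ • eVec n) r with hBy
  set z := tubePt n x (y + δ • eVec n) with hz
  have hBxm : MeasurableSet Bx := Metric.isClosed_closedBall.measurableSet
  have hBym : MeasurableSet By := Metric.isClosed_closedBall.measurableSet
  have hByΛ : ∀ u ∈ By, u ∈ lightCone n ∧ 1 ≤ R ^ a * lorentzQ n u ^ s := by
    intro u hu
    have hv : ∀ k, |(u - (y + δ • eVec n)) k| ≤ r := by
      intro k
      rw [hBy, Metric.mem_closedBall, dist_eq_norm] at hu
      exact (norm_le_pi_norm (u - (y + δ • eVec n)) k).trans hu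
    have hb := hbox _ hv
    have hu' : u = y + (δ • eVec n + (u - (y + δ • eVec n))) := by abel
    have hmem : u ∈ lightCone n := hu' ▸ add_mem_lightCone hy hb.1
    have hlow : r ^ 2 ≤ lorentzQ n u := hb.2.trans (by
      conv_rhs => rw [hu']
      exact lorentzQ_le_add hy hb.1)
    have hup : lorentzQ n u ≤ ((1 + 2 * δ) * (1 + y 0)) ^ 2 := by
      refine (lorentzQ_le_sq u).trans (pow_le_pow_left₀ hmem.1.le ?_ 2)
      have h0 := (abs_le.1 (hv 0)).2
      simp [eVec] at h0
      nlinarith [mul_pos hδ hy0]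
    have hr2 : 0 < (r ^ 2)⁻¹ := by positivity
    have hδ1 : 1 ≤ (1 + 2 * δ) ^ 2 := one_le_pow₀ (by linarith)
    have hy1 : 1 ≤ (1 + y 0) ^ 2 := one_le_pow₀ (by linarith)
    have hd1 : 1 ≤ (1 + 2 * δ) ^ 2 * (1 + y 0) ^ 2 := one_le_mul_of_one_le_of_one_le hδ1 hy1
    have hReq : R = ((1 + 2 * δ) ^ 2 * (1 + y 0) ^ 2) * (1 + (r ^ 2)⁻¹) := by
      rw [hR, hK]; ring
    refine ⟨hmem, one_le_pow_mul_rpow hmem.2 ?_ ?_ ?_ (Nat.le_ceil _)⟩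
    · rw [hReq]; nlinarith
    · rw [mul_pow] at hup
      rw [hReq]; nlinarith
    · refine (inv_anti₀ (by positivity) hlow).trans ?_
      rw [hReq]; nlinarith
  have hsub : Metric.closedBall z r ⊆ (fun v : (Fin n → ℝ) × (Fin n → ℝ) => tubePt n v.1 v.2) ''
      (Bx ×ˢ By) := by
    intro w hw
    refine ⟨(fun k => (w k).re, fun k => (w k).im), ⟨?_, ?_⟩, by ext k; simp [tubePt]⟩
    · simp only [hBx, Metric.mem_closedBall]
      refine (dist_pi_le_iff hr.le).2 fun k => ?_
      have h1 := (dist_pi_le_iff hr.le).1 (Metric.mem_closedBall.1 hw) k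
      rw [Complex.dist_eq] at h1
      refine le_trans ?_ ((abs_re_le_norm _).trans h1)
      simp [Real.dist_eq, hz, tubePt]
    · simp only [hBy, Metric.mem_closedBall]
      refine (dist_pi_le_iff hr.le).2 fun k => ?_
      have h1 := (dist_pi_le_iff hr.le).1 (Metric.mem_closedBall.1 hw) k
      rw [Complex.dist_eq] at h1
      refine le_trans ?_ ((abs_im_le_norm _).trans h1)
      simp [Real.dist_eq, hz, tubePt]
  have hballU : Metric.closedBall z r ⊆ tubeSet n := by
    intro w hw
    obtain ⟨v, hv, rfl⟩ := hsub hw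
    exact tubePt_mem_tubeSet.2 (hByΛ _ hv.2).1
  have hinner : ∀ u ∈ By, ∫⁻ x' in Bx, ‖F (tubePt n x' u)‖ₑ ≤ V ^ (1 - 1 / p) *
      (1 + ENNReal.ofReal (R ^ a) * (H u ^ (q / p) * ENNReal.ofReal (lorentzQ n u ^ s))) := by
    intro u hu
    obtain ⟨hu1, hu2⟩ := hByΛ u hu
    have hcont := (continuous_slice hol hu1).enorm.measurable
    have hVx : volume Bx = V := by rw [hBx, hV, Measure.addHaar_closedBall_center]
    calc ∫⁻ x' in Bx, ‖F (tubePt n x' u)‖ₑ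
        ≤ (∫⁻ x' in Bx, ‖F (tubePt n x' u)‖ₑ ^ p) ^ (1 / p) * V ^ (1 - 1 / p) := by
          have := lintegral_le_rpow_lintegral_rpow (μ := volume.restrict Bx) hp hcont.aemeasurable
          rwa [Measure.restrict_apply_univ, hVx] at this
      _ ≤ H u ^ (1 / p) * V ^ (1 - 1 / p) := by
          gcongr
          exact setLIntegral_le_lintegral _ _
      _ ≤ (1 + H u ^ (q / p)) * V ^ (1 - 1 / p) := by
          gcongr
          rcases le_total (H u) 1 with h | h
          · exact (ENNReal.rpow_le_one h (by positivity)).trans le_self_add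
          · refine le_trans (ENNReal.rpow_le_rpow_of_exponent_le h ?_) le_add_self
            gcongr
      _ ≤ _ := by
          rw [mul_comm]
          gcongr
          rw [mul_left_comm, ← ENNReal.ofReal_mul (by positivity)]
          refine le_mul_of_one_le_right' ?_
          simpa using ENNReal.ofReal_le_ofReal hu2
  have hmain : ‖F z‖ₑ * V₂ ≤ V ^ (1 - 1 / p) * (V + ENNReal.ofReal (R ^ a) * J) := by
    have hBm : MeasurableSet (Metric.closedBall z r) := Metric.isClosed_closedBall.measurableSet
    have hm : Measurable ((Metric.closedBall z r).indicator fun w => ‖F w‖ₑ) :=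
      ContinuousOn.measurable_indicator (hol.continuousOn.mono hballU).enorm hBm
    calc ‖F z‖ₑ * V₂ ≤ ∫⁻ w in Metric.closedBall z r, ‖F w‖ₑ :=
          enorm_mul_volume_le isOpen_tubeSet hol hballU
      _ = ∫⁻ u, ∫⁻ x', (Metric.closedBall z r).indicator (fun w => ‖F w‖ₑ) (tubePt n x' u) := by
          rw [← lintegral_indicator hBm, lintegral_eq_lintegral_tubePt hm]
      _ ≤ ∫⁻ u, By.indicator (fun u => ∫⁻ x' in Bx, ‖F (tubePt n x' u)‖ₑ) u := by
          refine lintegral_mono fun u => ?_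
          by_cases hu : u ∈ By
          · rw [indicator_of_mem hu, ← lintegral_indicator hBxm]
            refine lintegral_mono fun x' => ?_
            by_cases hx' : tubePt n x' u ∈ Metric.closedBall z r
            · have hx'B : x' ∈ Bx := by
                obtain ⟨v, hv, hve⟩ := hsub hx'
                have : v.1 = x' := by
                  ext k
                  simpa [tubePt] using congrArg re (congrFun hve k)
                exact this ▸ hv.1
              rw [indicator_of_mem hx', indicator_of_mem hx'B]
            · rw [indicator_of_notMem hx']; exact zero_le
          · rw [indicator_of_notMem hu, nonpos_iff_eq_zero]
            rw [← lintegral_zero (μ := (volume : Measure (Fin n → ℝ)))]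
            refine lintegral_congr fun x' => indicator_of_notMem (fun hx' => hu ?_) _
            obtain ⟨v, hv, hve⟩ := hsub hx'
            have : v.2 = u := by
              ext k
              simpa [tubePt] using congrArg im (congrFun hve k)
            exact this ▸ hv.2
      _ = ∫⁻ u in By, ∫⁻ x' in Bx, ‖F (tubePt n x' u)‖ₑ := lintegral_indicator hBym _
      _ ≤ ∫⁻ u in By, V ^ (1 - 1 / p) *
          (1 + ENNReal.ofReal (R ^ a) * (H u ^ (q / p) * ENNReal.ofReal (lorentzQ n u ^ s))) :=
          setLIntegral_mono' hBym hinner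
      _ = V ^ (1 - 1 / p) * (V + ENNReal.ofReal (R ^ a) *
            ∫⁻ u in By, H u ^ (q / p) * ENNReal.ofReal (lorentzQ n u ^ s)) := by
          have h1 : 0 ≤ 1 - 1 / p := by
            rw [sub_nonneg, div_le_one hp0]; exact hp
          rw [lintegral_const_mul' _ _ (ENNReal.rpow_ne_top_of_nonneg h1 hVtop),
            lintegral_add_left measurable_const, lintegral_const_mul' _ _ ENNReal.ofReal_ne_top,
            setLIntegral_const, one_mul, hBy, Measure.addHaar_closedBall_center]
      _ ≤ _ := by
          gcongr
          exact lintegral_mono_set fun u hu => (hByΛ u hu).1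
  have hfinal : ‖F z‖ₑ ≤ c * ENNReal.ofReal ((1 + y 0) ^ (2 * a)) := by
    have hge : (1 : ℝ≥0∞) ≤ ENNReal.ofReal ((1 + y 0) ^ (2 * a)) := by
      simpa using ENNReal.ofReal_le_ofReal (one_le_pow₀ (by linarith : 1 ≤ 1 + y 0) (n := 2 * a))
    rw [hc, ENNReal.mul_comm_div, ← mul_div_assoc,
      ENNReal.le_div_iff_mul_le (Or.inl hV₂0) (Or.inl hV₂top)]
    refine hmain.trans ?_
    rw [mul_assoc]
    gcongr
    rw [add_mul, hR, mul_pow, ← pow_mul, ENNReal.ofReal_mul (by positivity), mul_right_comm]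
    gcongr
    exact le_mul_of_one_le_right' hge
  rw [← ofReal_norm, ← ENNReal.ofReal_toReal hctop,
    ← ENNReal.ofReal_mul ENNReal.toReal_nonneg] at hfinal
  exact (ENNReal.ofReal_le_ofReal_iff (by positivity)).1 hfinal

end PointwiseBound

section Monotonicity

/-- Differentiation under the integral sign for locally bounded holomorphic families. -/
lemma differentiableOn_integral_of_bounded {α : Type*} [MeasurableSpace α] {μ : Measure α}
    [IsFiniteMeasure μ] {U : Set ℂ} (hU : IsOpen U) {h : ℂ → α → ℂ}
    (hmeas : ∀ ζ ∈ U, AEStronglyMeasurable (h ζ) μ)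
    (hdiff : ∀ a, DifferentiableOn ℂ (fun ζ => h ζ a) U)
    (hbd : ∀ ζ₀ ∈ U, ∃ D : ℝ, ∀ᶠ ζ in 𝓝 ζ₀, ∀ a, ‖h ζ a‖ ≤ D) :
    DifferentiableOn ℂ (fun ζ => ∫ a, h ζ a ∂μ) U := by
  intro ζ₀ hζ₀
  obtain ⟨D, hD⟩ := hbd ζ₀ hζ₀
  obtain ⟨r, hr, hball⟩ := Metric.mem_nhds_iff.1 (hD.and (hU.mem_nhds hζ₀))
  have hbound : ∀ ζ ∈ Metric.ball ζ₀ (r / 2), ∀ a, ‖deriv (fun ζ => h ζ a) ζ‖ ≤ D / (r / 4) := by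
    intro ζ hζ a
    have hsub : Metric.closedBall ζ (r / 4) ⊆ Metric.ball ζ₀ r := by
      intro w hw
      have h1 := Metric.mem_closedBall.1 hw
      have h2 := Metric.mem_ball.1 hζ
      exact Metric.mem_ball.2 (by linarith [dist_triangle w ζ ζ₀])
    refine norm_deriv_le_of_forall_mem_sphere_norm_le (by positivity) ?_ fun w hw =>
      (hball (hsub (Metric.sphere_subset_closedBall hw))).1 a
    refine DifferentiableOn.diffContOnCl ?_
    rw [closure_ball _ (by positivity)]
    exact (hdiff a).mono fun w hw => (hball (hsub hw)).2
  have hderiv : ∀ ζ ∈ U, ∀ a, HasDerivAt (fun ζ => h ζ a) (deriv (fun ζ => h ζ a) ζ) ζ :=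
    fun ζ hζ a => ((hdiff a).differentiableAt (hU.mem_nhds hζ)).hasDerivAt
  have hseq : Tendsto (fun k : ℕ => ζ₀ + ((r / (k + 2) : ℝ) : ℂ)) atTop (𝓝[≠] ζ₀) := by
    refine tendsto_nhdsWithin_iff.2 ⟨?_, Eventually.of_forall fun k => ?_⟩
    · have h1 : Tendsto (fun k : ℕ => r / ((k : ℝ) + 2)) atTop (𝓝 0) :=
        tendsto_const_nhds.div_atTop
          (tendsto_atTop_add_const_right _ _ tendsto_natCast_atTop_atTop)
      simpa using tendsto_const_nhds.add ((continuous_ofReal.tendsto 0).comp h1)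
    · have : r / ((k : ℝ) + 2) ≠ 0 := by positivity
      simpa using ofReal_ne_zero.2 this
  have hmem : ∀ k : ℕ, ζ₀ + ((r / (k + 2) : ℝ) : ℂ) ∈ U := by
    intro k
    refine (hball (Metric.mem_ball.2 ?_)).2
    rw [dist_self_add_left, norm_real, Real.norm_of_nonneg (by positivity)]
    exact div_lt_self hr (by linarith [k.cast_nonneg (α := ℝ)])
  have hF'meas : AEStronglyMeasurable (fun a => deriv (fun ζ => h ζ a) ζ₀) μ := by
    refine aestronglyMeasurable_of_tendsto_ae atTop
      (f := fun (k : ℕ) a => slope (fun ζ => h ζ a) ζ₀ (ζ₀ + ((r / (k + 2) : ℝ) : ℂ)))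
      (fun k => ?_) (ae_of_all _ fun a => ?_)
    · simp only [slope, vsub_eq_sub]
      have hsub : AEStronglyMeasurable
          (fun a => h (ζ₀ + ((r / (k + 2) : ℝ) : ℂ)) a - h ζ₀ a) μ := (hmeas _ (hmem k)).sub (hmeas _ hζ₀)
      exact hsub.const_smul ((ζ₀ + ((r / (k + 2) : ℝ) : ℂ) - ζ₀)⁻¹)
    · exact (hasDerivAt_iff_tendsto_slope.1 (hderiv ζ₀ hζ₀ a)).comp hseq
  have hint : Integrable (h ζ₀) μ :=
    Integrable.of_bound (hmeas _ hζ₀) D (ae_of_all _ (hball (Metric.mem_ball_self hr)).1)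
  exact (hasDerivAt_integral_of_dominated_loc_of_deriv_le (Metric.ball_mem_nhds ζ₀ (half_pos hr))
    (eventually_of_mem (hU.mem_nhds hζ₀) hmeas) hint hF'meas
    (ae_of_all _ fun a ζ hζ => hbound ζ hζ a) (integrable_const _)
    (ae_of_all _ fun a ζ hζ => hderiv ζ
      (hball (Metric.ball_subset_ball (by linarith) hζ)).2 a)).2.differentiableAt.differentiableWithinAt

/-- A Phragmén–Lindelöf principle for functions of polynomial growth in the right half-plane. -/
lemma norm_le_of_polynomial_growth {f : ℂ → ℂ} {B C : ℝ} {M : ℕ}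
    (hd : DiffContOnCl ℂ f {z | 0 < z.re})
    (hg : ∀ ζ : ℂ, 0 ≤ ζ.re → ‖f ζ‖ ≤ C * (1 + ‖ζ‖) ^ M)
    (him : ∀ x : ℝ, ‖f (x * I)‖ ≤ B) {z : ℂ} (hz : 0 ≤ z.re) : ‖f z‖ ≤ B := by
  have hC : 0 ≤ C := by simpa using (norm_nonneg _).trans (hg 0 le_rfl)
  have hre : ∀ ε : ℝ, 0 < ε → ∀ ζ : ℂ, 0 ≤ ζ.re → 1 ≤ ‖1 + ε * ζ‖ := by
    intro ε hε ζ hζ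
    refine le_trans ?_ (re_le_norm _)
    simpa using mul_nonneg hε.le hζ
  have hmain : ∀ ε : ℝ, 0 < ε → ε < 1 → ‖f z * ((1 + ε * z) ^ M)⁻¹‖ ≤ B := by
    intro ε hε hε1
    have hle : ∀ ζ : ℂ, 0 ≤ ζ.re → ‖f ζ * ((1 + ε * ζ) ^ M)⁻¹‖ ≤ ‖f ζ‖ := by
      intro ζ hζ
      rw [norm_mul, norm_inv, norm_pow]
      exact mul_le_of_le_one_right (norm_nonneg _) (inv_le_one_of_one_le₀ (one_le_pow₀ (hre ε hε ζ hζ)))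
    refine PhragmenLindelof.right_half_plane_of_bounded_on_real
      (f := fun ζ => f ζ * ((1 + ε * ζ) ^ M)⁻¹) ?_ ⟨1, by norm_num, M, ?_⟩ ?_ ?_ hz
    · refine DiffContOnCl.smul (c := f) (f := fun ζ : ℂ => ((1 + ε * ζ) ^ M)⁻¹) hd ?_
      refine DifferentiableOn.diffContOnCl fun ζ hζ => ?_
      have hζ' : 0 ≤ ζ.re := by
        have : closure {z : ℂ | 0 < z.re} = {z | 0 ≤ z.re} := closure_setOfPred_lt_re 0
        rw [this] at hζ; exact hζ
      have hne : (1 + ε * ζ) ^ M ≠ 0 := by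
        refine pow_ne_zero _ (norm_pos_iff.1 (lt_of_lt_of_le one_pos (hre ε hε ζ hζ')))
      have hpow : DifferentiableAt ℂ (fun ζ : ℂ => (1 + ε * ζ) ^ M) ζ := by fun_prop
      exact (hpow.inv hne).differentiableWithinAt
    · refine Asymptotics.IsBigO.of_bound C ?_
      refine eventually_inf_principal.2 (Eventually.of_forall fun ζ hζ => ?_)
      have hζ' : 0 ≤ ζ.re := le_of_lt hζ
      refine (hle ζ hζ').trans ((hg ζ hζ').trans ?_)
      rw [Real.rpow_one, Real.norm_of_nonneg (Real.exp_pos _).le, mul_comm (M : ℝ), mul_comm,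
        mul_comm C, mul_comm ‖ζ‖, Real.exp_nat_mul]
      gcongr
      linarith [Real.add_one_le_exp ‖ζ‖]
    · refine ⟨C * (ε⁻¹) ^ M, ?_⟩
      simp only [eventually_map]
      filter_upwards [eventually_ge_atTop (0 : ℝ)] with x hx
      rw [norm_mul, norm_inv, norm_pow]
      have h1 := hg x (by simpa using hx)
      rw [norm_real, Real.norm_of_nonneg hx] at h1
      have h2 : ‖(1 : ℂ) + ε * x‖ = 1 + ε * x := by
        rw [← ofReal_one, ← ofReal_mul, ← ofReal_add, norm_real, Real.norm_of_nonneg (by positivity)]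
      have h3 : (1 + x) ≤ ε⁻¹ * (1 + ε * x) := by
        rw [mul_add, mul_one, inv_mul_cancel_left₀ hε.ne']
        linarith [(one_lt_inv₀ hε).2 hε1]
      rw [h2, ← div_eq_mul_inv, div_le_iff₀ (by positivity)]
      calc ‖f x‖ ≤ C * (1 + x) ^ M := h1
        _ ≤ C * (ε⁻¹ * (1 + ε * x)) ^ M := by gcongr
        _ = _ := by rw [mul_pow, mul_assoc]
    · intro x
      exact (hle _ (by simp)).trans (him x)
  have hlim : Tendsto (fun ε : ℝ => ‖f z * ((1 + ε * z) ^ M)⁻¹‖) (𝓝[>] 0) (𝓝 ‖f z‖) := by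
    have hc : ContinuousAt (fun ε : ℝ => ‖f z * ((1 + ε * z) ^ M)⁻¹‖) 0 := by
      refine (continuousAt_const.mul (ContinuousAt.inv₀ (by fun_prop) (by simp))).norm
    have := hc.tendsto
    simp only [ofReal_zero, zero_mul, add_zero, one_pow, inv_one, mul_one] at this
    exact this.mono_left nhdsWithin_le_nhds
  refine le_of_tendsto hlim ?_
  filter_upwards [Ioo_mem_nhdsGT (zero_lt_one' ℝ)] with ε hε using hmain ε hε.1 hε.2

lemma mul_rpow_sub_one_le {p a b : ℝ} (hp : 1 ≤ p) (ha : 0 ≤ a) (hb : 0 ≤ b) :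
    a * b ^ (p - 1) ≤ (1 / p) * a ^ p + (1 - 1 / p) * b ^ p := by
  have hp0 : 0 < p := by linarith
  have h := Real.geom_mean_le_arith_mean2_weighted (w₁ := 1 / p) (w₂ := 1 - 1 / p)
    (by positivity) (by rw [sub_nonneg, div_le_one hp0]; exact hp) (Real.rpow_nonneg ha p)
    (Real.rpow_nonneg hb p) (by ring)
  rwa [← Real.rpow_mul ha, ← Real.rpow_mul hb, mul_one_div_cancel hp0.ne', Real.rpow_one,
    show p * (1 - 1 / p) = p - 1 by field_simp] at h

variable {n : ℕ} [NeZero n] {F : (Fin n → ℂ) → ℂ}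

/-- `∫ |F(x+iy)|^p dx` decreases when `y` moves in the direction `e`. -/
lemma lintegral_slice_add_smul_eVec_le {p : ℝ} (hp : 1 ≤ p)
    (hol : DifferentiableOn ℂ F (tubeSet n))
    (hbd : ∀ δ : ℝ, 0 < δ → ∃ (C : ℝ) (M : ℕ), 0 ≤ C ∧ ∀ x y : Fin n → ℝ, y ∈ lightCone n →
      ‖F (tubePt n x (y + δ • eVec n))‖ ≤ C * (1 + y 0) ^ M)
    {y : Fin n → ℝ} (hy : y ∈ lightCone n) {t : ℝ} (ht : 0 ≤ t) :
    ∫⁻ x, ‖F (tubePt n x (y + t • eVec n))‖ₑ ^ p ≤ ∫⁻ x, ‖F (tubePt n x y)‖ₑ ^ p := by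
  have hp0 : 0 < p := by linarith
  by_cases hH : ∫⁻ x, ‖F (tubePt n x y)‖ₑ ^ p = ∞
  · rw [hH]; exact le_top
  obtain ⟨δ, hδ, hyδ⟩ := exists_sub_smul_eVec_mem_lightCone hy
  obtain ⟨C, M, hC, hCM⟩ := hbd (δ / 2) (by positivity)
  have hy0 : 0 < y 0 := hy.1
  have hcone : ∀ τ : ℝ, -(δ / 2) < τ → y + τ • eVec n ∈ lightCone n := by
    intro τ hτ
    have h1 := add_smul_eVec_mem_lightCone (t := δ + τ) (by linarith) hyδ
    convert h1 using 1
    module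
  have hgrow : ∀ (x : Fin n → ℝ) (τ : ℝ), -(δ / 2) < τ →
      ‖F (tubePt n x (y + τ • eVec n))‖ ≤ C * (1 + y 0) ^ M * (1 + |τ|) ^ M := by
    intro x τ hτ
    have h1 := add_smul_eVec_mem_lightCone (t := δ / 2 + τ) (by linarith) hyδ
    have h2 := hCM x _ h1
    have h3 : y - δ • eVec n + (δ / 2 + τ) • eVec n + (δ / 2) • eVec n = y + τ • eVec n := by
      module
    rw [h3] at h2
    refine h2.trans ?_
    rw [mul_assoc, ← mul_pow]
    have h4 := h1.1
    simp only [Pi.add_apply, Pi.sub_apply, Pi.smul_apply, eVec, if_true, smul_eq_mul, mul_one] at h4 ⊢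
    gcongr
    nlinarith [le_abs_self τ, abs_nonneg τ]
  set u : (Fin n → ℝ) → ℂ := fun x => F (tubePt n x (y + t • eVec n)) with hu
  set v : (Fin n → ℝ) → ℂ := fun x => F (tubePt n x y) with hv
  have huc : Continuous u := continuous_slice hol (hcone t (by linarith))
  have hvc : Continuous v := continuous_slice hol hy
  set D := C * (1 + y 0) ^ M * (1 + |t|) ^ M with hD
  have huD : ∀ x, ‖u x‖ ≤ D := fun x => hgrow x t (by linarith)
  have hD0 : 0 ≤ D := by positivity
  set φ : (Fin n → ℝ) → ℂ := fun x => (starRingEnd ℂ) (u x) * ((‖u x‖ ^ (p - 2) : ℝ) : ℂ) with hφ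
  have hφm : Measurable φ := by
    have := huc.measurable
    exact ((continuous_conj.measurable).comp this).mul
      (measurable_ofReal.comp ((this.norm).pow_const _))
  have huφ : ∀ x, u x * φ x = ((‖u x‖ ^ p : ℝ) : ℂ) := by
    intro x
    rw [hφ]
    simp only
    rw [← mul_assoc, mul_conj, normSq_eq_norm_sq, ← ofReal_mul]
    congr 1
    rcases (norm_nonneg (u x)).eq_or_lt with h | h
    · rw [← h]; simp [hp0.ne']
    · rw [← Real.rpow_natCast, ← Real.rpow_add h]; norm_num
  have hφn : ∀ x, ‖φ x‖ ≤ ‖u x‖ ^ (p - 1) := by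
    intro x
    rw [hφ]
    simp only
    rw [norm_mul, RCLike.norm_conj, norm_real, Real.norm_of_nonneg (by positivity)]
    rcases (norm_nonneg (u x)).eq_or_lt with h | h
    · rw [← h]; simp [Real.rpow_nonneg]
    · conv_lhs => rw [← Real.rpow_one ‖u x‖, ← Real.rpow_mul h.le, ← Real.rpow_add h]
      apply le_of_eq; ring_nf
  have hφD : ∀ x, ‖φ x‖ ≤ D ^ (p - 1) := fun x => (hφn x).trans
    (Real.rpow_le_rpow (norm_nonneg _) (huD x) (by linarith))
  have hvint : Integrable (fun x => ‖v x‖ ^ p) := by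
    refine ⟨(hvc.measurable.norm.pow_const p).aestronglyMeasurable, ?_⟩
    rw [hasFiniteIntegral_iff_enorm]
    refine lt_of_eq_of_lt (lintegral_congr fun x => ?_) (lt_top_iff_ne_top.2 hH)
    rw [Real.enorm_rpow_of_nonneg (norm_nonneg _) hp0.le, enorm_norm]
  set H := ∫ x, ‖v x‖ ^ p with hHdef
  have hHeq : ENNReal.ofReal H = ∫⁻ x, ‖v x‖ₑ ^ p := by
    rw [hHdef, ofReal_integral_eq_lintegral_ofReal hvint (ae_of_all _ fun x => by positivity)]
    refine lintegral_congr fun x => ?_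
    rw [← ENNReal.ofReal_rpow_of_nonneg (norm_nonneg _) hp0.le, ofReal_norm]
  refine lintegral_le_of_forall_fin_meas_le _ fun K hK hKfin => ?_
  have : IsFiniteMeasure (volume.restrict K) := ⟨by
    rw [Measure.restrict_apply_univ]; exact lt_top_iff_ne_top.2 hKfin⟩
  have huint : Integrable (fun x => ‖u x‖ ^ p) (volume.restrict K) := by
    refine Integrable.of_bound (huc.measurable.norm.pow_const p).aestronglyMeasurable (D ^ p)
      (ae_of_all _ fun x => ?_)
    rw [Real.norm_of_nonneg (by positivity)]
    exact Real.rpow_le_rpow (norm_nonneg _) (huD x) hp0.le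
  set A := ∫ x in K, ‖u x‖ ^ p with hA
  have hAeq : ENNReal.ofReal A = ∫⁻ x in K, ‖u x‖ₑ ^ p := by
    rw [hA, ofReal_integral_eq_lintegral_ofReal huint (ae_of_all _ fun x => by positivity)]
    refine lintegral_congr fun x => ?_
    rw [← ENNReal.ofReal_rpow_of_nonneg (norm_nonneg _) hp0.le, ofReal_norm]
  rw [← hAeq, ← hHeq]
  refine ENNReal.ofReal_le_ofReal ?_
  set h : ℂ → (Fin n → ℝ) → ℂ := fun ζ x => F (tubePt n x y + (I * ζ) • eVecC n) * φ x with hh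
  have hpt : ∀ (ζ : ℂ) x, tubePt n x y + (I * ζ) • eVecC n =
      tubePt n (x + (-ζ.im) • eVec n) (y + ζ.re • eVec n) := by
    intro ζ x
    rw [tubePt_add_smul_eVecC]
    simp
  set U : Set ℂ := {ζ | -(δ / 2) < ζ.re} with hU
  have hUo : IsOpen U := isOpen_lt continuous_const continuous_re
  have hhbd : ∀ ζ ∈ U, ∀ x, ‖h ζ x‖ ≤ C * (1 + y 0) ^ M * (1 + ‖ζ‖) ^ M * D ^ (p - 1) := by
    intro ζ hζ x
    rw [hh]
    simp only
    rw [norm_mul, hpt]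
    refine mul_le_mul ((hgrow _ _ hζ).trans ?_) (hφD x) (norm_nonneg _) (by positivity)
    gcongr
    exact abs_re_le_norm ζ
  have hdiff : DifferentiableOn ℂ (fun ζ => ∫ x in K, h ζ x) U := by
    refine differentiableOn_integral_of_bounded hUo (fun ζ hζ => ?_) (fun x ζ hζ => ?_)
      fun ζ₀ hζ₀ => ⟨C * (1 + y 0) ^ M * (1 + (‖ζ₀‖ + 1)) ^ M * D ^ (p - 1), ?_⟩
    · refine Measurable.aestronglyMeasurable (Measurable.mul ?_ hφm)
      simp only [hpt]
      exact ((continuous_slice hol (hcone _ hζ)).comp (by fun_prop)).measurable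
    · have hmem : tubePt n x y + (I * ζ) • eVecC n ∈ tubeSet n := by
        rw [hpt]; exact tubePt_mem_tubeSet.2 (hcone _ hζ)
      have hFd : DifferentiableAt ℂ F (tubePt n x y + (I * ζ) • eVecC n) :=
        hol.differentiableAt (isOpen_tubeSet.mem_nhds hmem)
      have hl : DifferentiableAt ℂ (fun ζ : ℂ => tubePt n x y + (I * ζ) • eVecC n) ζ := by fun_prop
      exact ((DifferentiableAt.comp ζ hFd hl).mul_const (φ x)).differentiableWithinAt
    · filter_upwards [hUo.mem_nhds hζ₀, Metric.ball_mem_nhds ζ₀ one_pos] with ζ hζ hζ1 x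
      refine (hhbd ζ hζ x).trans ?_
      have : ‖ζ‖ ≤ ‖ζ₀‖ + 1 := by
        have h1 := norm_sub_norm_le ζ ζ₀
        have h2 := Metric.mem_ball.1 hζ1
        rw [dist_eq_norm] at h2
        linarith
      gcongr
  have hUcl : closure {ζ : ℂ | 0 < ζ.re} ⊆ U := by
    have : closure {z : ℂ | 0 < z.re} = {z | 0 ≤ z.re} := closure_setOfPred_lt_re 0
    rw [this]
    intro ζ hζ
    have : 0 ≤ ζ.re := hζ
    change -(δ / 2) < ζ.re
    linarith
  have him : ∀ s : ℝ, ‖∫ x in K, h (s * I) x‖ ≤ (1 / p) * H + (1 - 1 / p) * A := by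
    intro s
    have hvs : Integrable (fun x => ‖v (x + (-s) • eVec n)‖ ^ p) :=
      hvint.comp_add_right ((-s) • eVec n)
    calc ‖∫ x in K, h (s * I) x‖
        ≤ ∫ x in K, ((1 / p) * ‖v (x + (-s) • eVec n)‖ ^ p + (1 - 1 / p) * ‖u x‖ ^ p) := by
          refine norm_integral_le_of_norm_le
            ((hvs.restrict.const_mul _).add (huint.const_mul _)) (ae_of_all _ fun x => ?_)
          rw [hh]
          simp only
          rw [norm_mul, hpt]
          have h1 : F (tubePt n (x + -(↑s * I : ℂ).im • eVec n) (y + (↑s * I : ℂ).re • eVec n)) =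
              v (x + (-s) • eVec n) := by
            simp [hv]
          rw [h1]
          exact (mul_le_mul_of_nonneg_left (hφn x) (norm_nonneg _)).trans
            (mul_rpow_sub_one_le hp (norm_nonneg _) (norm_nonneg _))
      _ = (1 / p) * (∫ x in K, ‖v (x + (-s) • eVec n)‖ ^ p) + (1 - 1 / p) * A := by
          rw [integral_add (hvs.restrict.const_mul _) (huint.const_mul _), integral_const_mul,
            integral_const_mul]
      _ ≤ _ := by
          gcongr
          refine (setIntegral_le_integral hvs (ae_of_all _ fun x => by positivity)).trans ?_
          exact (integral_add_right_eq_self (fun x => ‖v x‖ ^ p) ((-s) • eVec n)).le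
  have hfin := norm_le_of_polynomial_growth (f := fun ζ => ∫ x in K, h ζ x) (z := (t : ℂ))
    (C := C * (1 + y 0) ^ M * D ^ (p - 1) * volume.real K) (M := M)
    (hdiff.mono hUcl).diffContOnCl (fun ζ hζ => ?_) him (by simpa using ht)
  · have h1 : ∫ x in K, h t x = (A : ℂ) := by
      rw [hA, ← integral_complex_ofReal]
      refine integral_congr_ae (ae_of_all _ fun x => ?_)
      simp only [hh]
      rw [hpt]
      simpa [hu] using huφ x
    rw [h1, norm_real] at hfin
    have h2 := (le_abs_self A).trans hfin
    have h3 : 1 / p * A ≤ 1 / p * H := by linarith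
    exact le_of_mul_le_mul_left h3 (by positivity)
  · have hζU : ζ ∈ U := by
      change -(δ / 2) < ζ.re
      linarith
    have h1 := norm_setIntegral_le_of_norm_le_const (μ := volume) (lt_top_iff_ne_top.2 hKfin)
      fun x _ => hhbd ζ hζU x
    refine h1.trans (le_of_eq ?_)
    ring

end Monotonicity

section Convergence

/-- Pointwise convergence together with `‖g j‖_p ≤ ‖f‖_p < ∞` implies convergence in `L^p`. -/
lemma tendsto_lintegral_rpow_sub_of_lintegral_le {α : Type*} [MeasurableSpace α] {μ : Measure α}
    {p : ℝ} (hp : 1 ≤ p) {f : α → ℂ} {g : ℕ → α → ℂ} (hf : Measurable f)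
    (hg : ∀ j, Measurable (g j)) (hlim : ∀ x, Tendsto (fun j => g j x) atTop (𝓝 (f x)))
    (hle : ∀ j, ∫⁻ x, ‖g j x‖ₑ ^ p ∂μ ≤ ∫⁻ x, ‖f x‖ₑ ^ p ∂μ)
    (hfin : ∫⁻ x, ‖f x‖ₑ ^ p ∂μ ≠ ∞) :
    Tendsto (fun j => ∫⁻ x, ‖f x - g j x‖ₑ ^ p ∂μ) atTop (𝓝 0) := by
  have hp0 : 0 < p := by linarith
  set c : ℝ≥0∞ := 2 ^ (p - 1) with hc
  have hctop : c ≠ ∞ := ENNReal.rpow_ne_top_of_nonneg (by linarith) (by simp)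
  set H := ∫⁻ x, ‖f x‖ₑ ^ p ∂μ with hH
  set A : ℕ → ℝ≥0∞ := fun j => ∫⁻ x, ‖f x - g j x‖ₑ ^ p ∂μ with hA
  set K := c * (H + H) with hK
  have hKtop : K ≠ ∞ := ENNReal.mul_ne_top hctop (ENNReal.add_ne_top.2 ⟨hfin, hfin⟩)
  have hpt : ∀ j x, ‖f x - g j x‖ₑ ^ p ≤ c * (‖f x‖ₑ ^ p + ‖g j x‖ₑ ^ p) := fun j x =>
    (ENNReal.rpow_le_rpow enorm_sub_le hp0.le).trans
      (ENNReal.rpow_add_le_mul_rpow_add_rpow _ _ hp)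
  have hfm : Measurable fun x => ‖f x‖ₑ ^ p := hf.enorm.pow_const p
  have hgm : ∀ j, Measurable fun x => ‖g j x‖ₑ ^ p := fun j => (hg j).enorm.pow_const p
  have hdm : ∀ j, Measurable fun x => ‖f x - g j x‖ₑ ^ p := fun j =>
    (hf.sub (hg j)).enorm.pow_const p
  set b : ℕ → α → ℝ≥0∞ := fun j x => c * (‖f x‖ₑ ^ p + ‖g j x‖ₑ ^ p) - ‖f x - g j x‖ₑ ^ p with hb
  have hbm : ∀ j, Measurable (b j) := fun j => ((hfm.add (hgm j)).const_mul c).sub (hdm j)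
  have hbA : ∀ j, ∫⁻ x, b j x ∂μ + A j ≤ K := by
    intro j
    rw [hA, ← lintegral_add_left (hbm j)]
    calc ∫⁻ x, b j x + ‖f x - g j x‖ₑ ^ p ∂μ
        = ∫⁻ x, c * (‖f x‖ₑ ^ p + ‖g j x‖ₑ ^ p) ∂μ :=
          lintegral_congr fun x => tsub_add_cancel_of_le (hpt j x)
      _ = c * (H + ∫⁻ x, ‖g j x‖ₑ ^ p ∂μ) := by
          rw [lintegral_const_mul' _ _ hctop, lintegral_add_left hfm]
      _ ≤ K := mul_le_mul' le_rfl (add_le_add le_rfl (hle j))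
  have hAK : ∀ j, A j ≤ K := fun j => le_add_self.trans (hbA j)
  have hblim : ∀ x, liminf (fun j => b j x) atTop = c * (‖f x‖ₑ ^ p + ‖f x‖ₑ ^ p) := by
    intro x
    refine Tendsto.liminf_eq ?_
    have h1 : Tendsto (fun j => ‖g j x‖ₑ ^ p) atTop (𝓝 (‖f x‖ₑ ^ p)) :=
      ((ENNReal.continuous_rpow_const.comp continuous_enorm).tendsto _).comp (hlim x)
    have h2 : Tendsto (fun j => ‖f x - g j x‖ₑ ^ p) atTop (𝓝 0) := by
      have h3 : Tendsto (fun j => f x - g j x) atTop (𝓝 0) := by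
        simpa using (tendsto_const_nhds (x := f x)).sub (hlim x)
      simpa [Function.comp_def, hp0] using
        ((ENNReal.continuous_rpow_const (y := p).comp continuous_enorm).tendsto (0 : ℂ)).comp h3
    have h4 := ENNReal.Tendsto.sub (ENNReal.Tendsto.const_mul (a := c)
      (tendsto_const_nhds (x := ‖f x‖ₑ ^ p).add h1) (Or.inr hctop)) h2 (Or.inr ENNReal.zero_ne_top)
    simpa using h4
  have hKle : K ≤ liminf (fun j => K - A j) atTop := by
    calc K = ∫⁻ x, liminf (fun j => b j x) atTop ∂μ := by
          simp_rw [hblim]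
          rw [lintegral_const_mul' _ _ hctop, lintegral_add_left hfm]
      _ ≤ liminf (fun j => ∫⁻ x, b j x ∂μ) atTop := lintegral_liminf_le hbm
      _ ≤ _ := by
          refine liminf_le_liminf (Eventually.of_forall fun j => ?_)
          exact ENNReal.le_sub_of_add_le_right ((hAK j).trans_lt hKtop.lt_top).ne (hbA j)
  rw [ENNReal.tendsto_nhds_zero]
  intro η hη
  rcases eq_or_ne K 0 with hK0 | hK0
  · exact Eventually.of_forall fun j => ((hAK j).trans hK0.le).trans bot_le
  · have h := eventually_lt_of_lt_liminf ((ENNReal.sub_lt_self hKtop hK0 hη.ne').trans_le hKle)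
    filter_upwards [h] with j hj
    exact (lt_of_tsub_lt_tsub_left hj).le

end Convergence

section Damping

variable {n : ℕ} [NeZero n]

/-- A polynomial without zeros on the tube domain, comparable from below to `1 + ‖z‖`. -/
def damping (n : ℕ) [NeZero n] (z : Fin n → ℂ) : ℂ := ∏ k, (1 - I * (2 * z 0 + z k))

lemma differentiable_damping : Differentiable ℂ (damping n) := by
  unfold damping; fun_prop

lemma damping_zero : damping n 0 = 1 := by simp [damping]

lemma norm_le_norm_damping {x y : Fin n → ℝ} (hy : y ∈ lightCone n) (k : Fin n) :
    ‖1 - I * (2 * tubePt n x y 0 + tubePt n x y k)‖ ≤ ‖damping n (tubePt n x y)‖ := by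
  have h1 : ∀ j, 1 ≤ ‖1 - I * (2 * tubePt n x y 0 + tubePt n x y j)‖ := by
    intro j
    have h0 : 0 ≤ 2 * y 0 + y j := by
      rcases eq_or_ne j 0 with rfl | hj
      · linarith [hy.1]
      · linarith [hy.1, (abs_lt.1 (abs_lt_of_mem_lightCone hy hj)).1]
    refine le_trans ?_ (re_le_norm _)
    simp [tubePt]
    linarith
  unfold damping
  rw [norm_prod, ← Finset.mul_prod_erase _ _ (Finset.mem_univ k)]
  exact le_mul_of_one_le_right (norm_nonneg _) (Finset.one_le_prod fun j _ => h1 j)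

lemma one_add_le_norm_damping {x y : Fin n → ℝ} (hy : y ∈ lightCone n) :
    1 + y 0 ≤ ‖damping n (tubePt n x y)‖ := by
  refine le_trans ?_ ((re_le_norm _).trans (norm_le_norm_damping hy 0))
  have := hy.1
  simp [tubePt]
  linarith

lemma one_add_norm_le_norm_damping {x y : Fin n → ℝ} (hy : y ∈ lightCone n) :
    1 + ‖x‖ ≤ 3 * ‖damping n (tubePt n x y)‖ := by
  have h1 : ∀ k, |2 * x 0 + x k| ≤ ‖damping n (tubePt n x y)‖ := by
    intro k
    refine le_trans (le_of_eq ?_) ((abs_im_le_norm _).trans (norm_le_norm_damping hy k))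
    simp [tubePt, ← abs_neg (2 * x 0 + x k)]
  have h2 : ‖x‖ ≤ 2 * ‖damping n (tubePt n x y)‖ := by
    refine (pi_norm_le_iff_of_nonneg (by positivity)).2 fun k => ?_
    have h3 := abs_le.1 (h1 0)
    have h4 := abs_le.1 (h1 k)
    rw [Real.norm_eq_abs, abs_le]
    constructor <;> linarith
  linarith [one_add_le_norm_damping (x := x) hy, hy.1]

end Damping

section Approximant

lemma smul_tubePt {n : ℕ} (t : ℝ) (x y : Fin n → ℝ) :
    (t : ℂ) • tubePt n x y = tubePt n (t • x) (t • y) := by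
  ext k
  simp [tubePt]
  ring

variable {n : ℕ} [NeZero n] {F : (Fin n → ℂ) → ℂ}

/-- `F` translated by `i t e` and divided by a power of a damping polynomial. -/
def approximant (n : ℕ) [NeZero n] (N : ℕ) (F : (Fin n → ℂ) → ℂ) (t : ℝ) (z : Fin n → ℂ) : ℂ :=
  F (z + (t * I) • eVecC n) * (damping n ((t : ℂ) • z) ^ N)⁻¹

lemma approximant_tubePt (N : ℕ) (t : ℝ) (x y : Fin n → ℝ) :
    approximant n N F t (tubePt n x y) =
      F (tubePt n x (y + t • eVec n)) * (damping n (tubePt n (t • x) (t • y)) ^ N)⁻¹ := by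
  rw [approximant, tubePt_add_smul_eVecC, smul_tubePt]
  simp

lemma one_le_norm_damping {t : ℝ} (ht : 0 < t) {x y : Fin n → ℝ} (hy : y ∈ lightCone n) :
    1 ≤ ‖damping n (tubePt n (t • x) (t • y))‖ := by
  have h := smul_mem_lightCone ht hy
  linarith [one_add_le_norm_damping (x := t • x) h, h.1]

lemma differentiableOn_approximant (N : ℕ) (hol : DifferentiableOn ℂ F (tubeSet n)) {t : ℝ}
    (ht : 0 < t) : DifferentiableOn ℂ (approximant n N F t) (tubeSet n) := by
  intro z hz
  obtain ⟨x, y, rfl⟩ : ∃ x y, z = tubePt n x y :=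
    ⟨fun k => (z k).re, fun k => (z k).im, by ext k; simp [tubePt]⟩
  have hy : y ∈ lightCone n := tubePt_mem_tubeSet.1 hz
  have hmem : tubePt n x y + (t * I) • eVecC n ∈ tubeSet n := by
    rw [tubePt_add_smul_eVecC, tubePt_mem_tubeSet]
    simpa using add_smul_eVec_mem_lightCone ht.le hy
  have h1 : DifferentiableAt ℂ (fun z => F (z + (t * I) • eVecC n)) (tubePt n x y) :=
    DifferentiableAt.comp (tubePt n x y) (hol.differentiableAt (isOpen_tubeSet.mem_nhds hmem))
      (by fun_prop)
  have h2 : DifferentiableAt ℂ (fun z => damping n ((t : ℂ) • z)) (tubePt n x y) :=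
    differentiable_damping.comp (f := fun z => (t : ℂ) • z) (by fun_prop) _
  have h3 : damping n ((t : ℂ) • tubePt n x y) ^ N ≠ 0 := by
    rw [smul_tubePt]
    exact pow_ne_zero _ (norm_pos_iff.1 (one_pos.trans_le (one_le_norm_damping ht hy)))
  exact (h1.mul ((h2.pow N).inv h3)).differentiableWithinAt

lemma norm_approximant_le (N : ℕ) {t : ℝ} (ht : 0 < t) {x y : Fin n → ℝ} (hy : y ∈ lightCone n) :
    ‖approximant n N F t (tubePt n x y)‖ ≤ ‖F (tubePt n x (y + t • eVec n))‖ := by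
  rw [approximant_tubePt, norm_mul, norm_inv, norm_pow]
  exact mul_le_of_le_one_right (norm_nonneg _)
    (inv_le_one_of_one_le₀ (one_le_pow₀ (one_le_norm_damping ht hy)))

lemma norm_approximant_le_mul_inv {C : ℝ} {M : ℕ} (m : ℕ) {t : ℝ} (ht : 0 < t) (ht1 : t ≤ 1)
    (hC : 0 ≤ C) (hF : ∀ x y : Fin n → ℝ, y ∈ lightCone n →
      ‖F (tubePt n x (y + t • eVec n))‖ ≤ C * (1 + y 0) ^ M)
    {x y : Fin n → ℝ} (hy : y ∈ lightCone n) :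
    ‖approximant n (M + m) F t (tubePt n x y)‖ ≤
      C * (t⁻¹) ^ M * (3 * t⁻¹) ^ m * ((1 + ‖x‖) ^ m)⁻¹ := by
  set D := ‖damping n (tubePt n (t • x) (t • y))‖ with hD
  have hty := smul_mem_lightCone ht hy
  have hy0 : 0 < y 0 := hy.1
  have hD1 : 1 ≤ D := one_le_norm_damping ht hy
  have hDy : 1 + y 0 ≤ t⁻¹ * D := by
    have h := one_add_le_norm_damping (x := t • x) hty
    simp only [Pi.smul_apply, smul_eq_mul] at h
    rw [inv_mul_eq_div, le_div_iff₀ ht]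
    linarith
  have hDx : 1 + ‖x‖ ≤ 3 * t⁻¹ * D := by
    have h := one_add_norm_le_norm_damping (x := t • x) hty
    rw [norm_smul, Real.norm_of_nonneg ht.le] at h
    rw [mul_assoc, mul_comm t⁻¹, ← mul_assoc, ← div_eq_mul_inv, le_div_iff₀ ht]
    linarith
  rw [approximant_tubePt, norm_mul, norm_inv, norm_pow]
  have h1 : (D ^ m)⁻¹ ≤ (3 * t⁻¹) ^ m * ((1 + ‖x‖) ^ m)⁻¹ := by
    rw [← div_eq_mul_inv, le_div_iff₀ (by positivity), inv_mul_le_iff₀ (by positivity), ← mul_pow]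
    refine pow_le_pow_left₀ (by positivity) ?_ m
    linarith
  calc ‖F (tubePt n x (y + t • eVec n))‖ * (D ^ (M + m))⁻¹
      ≤ C * (t⁻¹ * D) ^ M * (D ^ (M + m))⁻¹ := by
        gcongr
        exact (hF x y hy).trans (by gcongr)
    _ = C * (t⁻¹) ^ M * (D ^ m)⁻¹ := by
        rw [pow_add, mul_pow]
        field_simp
    _ ≤ C * (t⁻¹) ^ M * ((3 * t⁻¹) ^ m * ((1 + ‖x‖) ^ m)⁻¹) := by gcongr
    _ = _ := by ring

lemma iSup_lintegral_sq_lt_top {G : (Fin n → ℂ) → ℂ} {C : ℝ}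
    (hG : ∀ x y : Fin n → ℝ, y ∈ lightCone n →
      ‖G (tubePt n x y)‖ ≤ C * ((1 + ‖x‖) ^ (n + 1))⁻¹) :
    ⨆ y ∈ lightCone n, ∫⁻ x : Fin n → ℝ, ‖G (tubePt n x y)‖ₑ ^ (2 : ℝ) < ∞ := by
  set J := ∫⁻ x : Fin n → ℝ, ENNReal.ofReal ((1 + ‖x‖) ^ (-((n : ℝ) + 1))) with hJ
  have hJfin : J < ∞ := finite_integral_one_add_norm (by simp)
  refine lt_of_le_of_lt (iSup₂_le fun y hy => ?_)
    (ENNReal.mul_lt_top (ENNReal.ofReal_lt_top (r := C ^ 2)) hJfin)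
  rw [hJ, ← lintegral_const_mul' _ _ ENNReal.ofReal_ne_top]
  refine lintegral_mono fun x => ?_
  rw [← ENNReal.ofReal_mul (by positivity), ENNReal.rpow_two, ← ofReal_norm,
    ← ENNReal.ofReal_pow (norm_nonneg _)]
  refine ENNReal.ofReal_le_ofReal ((pow_le_pow_left₀ (norm_nonneg _) (hG x y hy) 2).trans ?_)
  have h1 : 1 ≤ (1 + ‖x‖) ^ (n + 1) := one_le_pow₀ (by linarith [norm_nonneg x])
  have h2 : (1 + ‖x‖) ^ (-((n : ℝ) + 1)) = ((1 + ‖x‖) ^ (n + 1))⁻¹ := by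
    rw [Real.rpow_neg (by positivity)]
    congr 1
    exact_mod_cast Real.rpow_natCast (1 + ‖x‖) (n + 1)
  rw [h2, mul_pow]
  gcongr
  exact pow_le_of_le_one (by positivity) (inv_le_one_of_one_le₀ h1) two_ne_zero

lemma tendsto_approximant (N : ℕ) (hol : DifferentiableOn ℂ F (tubeSet n)) {t : ℕ → ℝ}
    (ht : Tendsto t atTop (𝓝 0)) {z : Fin n → ℂ} (hz : z ∈ tubeSet n) :
    Tendsto (fun j => approximant n N F (t j) z) atTop (𝓝 (F z)) := by
  have hF : ContinuousAt F z := hol.continuousOn.continuousAt (isOpen_tubeSet.mem_nhds hz)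
  have hc : ContinuousAt (fun s : ℝ => approximant n N F s z) 0 := by
    unfold approximant
    refine ContinuousAt.mul (ContinuousAt.comp' ?_ (by fun_prop)) (ContinuousAt.inv₀ ?_ ?_)
    · simpa using hF
    · exact (differentiable_damping.continuous.comp (by fun_prop)).continuousAt.pow N
    · simp [damping_zero]
  have h := hc.tendsto.comp ht
  simpa [approximant, damping_zero, Function.comp_def] using h

end Approximant

section MixedNorm

variable {n : ℕ} [NeZero n] {F : (Fin n → ℂ) → ℂ}

lemma aemeasurable_lintegral_slice (p : ℝ) (hol : DifferentiableOn ℂ F (tubeSet n)) :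
    AEMeasurable (fun y => ∫⁻ x, ‖F (tubePt n x y)‖ₑ ^ p)
      ((volume : Measure (Fin n → ℝ)).restrict (lightCone n)) := by
  have hm : Measurable ((tubeSet n).indicator F) :=
    hol.continuousOn.measurable_indicator isOpen_tubeSet.measurableSet
  have h1 : Measurable fun v : (Fin n → ℝ) × (Fin n → ℝ) =>
      ‖(tubeSet n).indicator F (tubePt n v.2 v.1)‖ₑ ^ p :=
    ((hm.comp continuous_tubePt.measurable).comp measurable_swap).enorm.pow_const p
  refine ⟨_, h1.lintegral_prod_right' (ν := volume), ?_⟩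
  filter_upwards [ae_restrict_mem isOpen_lightCone.measurableSet] with y hy
  refine lintegral_congr fun x => ?_
  rw [indicator_of_mem (tubePt_mem_tubeSet.2 hy)]

lemma aemeasurable_mixedNorm_integrand (p q ν : ℝ) (hol : DifferentiableOn ℂ F (tubeSet n)) :
    AEMeasurable (fun y => (∫⁻ x, ‖F (tubePt n x y)‖ₑ ^ p) ^ (q / p) *
      ENNReal.ofReal (lorentzQ n y ^ (ν - (n : ℝ) / 2)))
      ((volume : Measure (Fin n → ℝ)).restrict (lightCone n)) :=
  ((aemeasurable_lintegral_slice p hol).pow_const _).mul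
    (continuous_lorentzQ.measurable.pow_const _).ennreal_ofReal.aemeasurable

lemma mixedNorm_mono {G : (Fin n → ℂ) → ℂ} {p q ν : ℝ} (hp : 0 < p) (hq : 0 < q)
    (hle : ∀ y ∈ lightCone n,
      ∫⁻ x, ‖G (tubePt n x y)‖ₑ ^ p ≤ ∫⁻ x, ‖F (tubePt n x y)‖ₑ ^ p) :
    mixedNorm n p q ν G ≤ mixedNorm n p q ν F := by
  refine ENNReal.rpow_le_rpow (setLIntegral_mono' isOpen_lightCone.measurableSet fun y hy => ?_)
    (by positivity)
  exact mul_le_mul' (ENNReal.rpow_le_rpow (hle y hy) (by positivity)) le_rfl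

lemma tendsto_mixedNorm_sub {G : ℕ → (Fin n → ℂ) → ℂ} {p q ν : ℝ} (hp : 1 ≤ p) (hq : 0 < q)
    (holF : DifferentiableOn ℂ F (tubeSet n)) (holG : ∀ j, DifferentiableOn ℂ (G j) (tubeSet n))
    (hfin : mixedNorm n p q ν F < ∞)
    (hle : ∀ j, ∀ y ∈ lightCone n,
      ∫⁻ x, ‖G j (tubePt n x y)‖ₑ ^ p ≤ ∫⁻ x, ‖F (tubePt n x y)‖ₑ ^ p)
    (hlim : ∀ z ∈ tubeSet n, Tendsto (fun j => G j z) atTop (𝓝 (F z))) :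
    Tendsto (fun j => mixedNorm n p q ν fun z => F z - G j z) atTop (𝓝 0) := by
  have hp0 : 0 < p := by linarith
  set s := ν - (n : ℝ) / 2 with hs
  set H : (Fin n → ℝ) → ℝ≥0∞ := fun y => ∫⁻ x, ‖F (tubePt n x y)‖ₑ ^ p with hH
  set A : ℕ → (Fin n → ℝ) → ℝ≥0∞ := fun j y =>
    ∫⁻ x, ‖F (tubePt n x y) - G j (tubePt n x y)‖ₑ ^ p with hA
  have hJfin : ∫⁻ y in lightCone n, H y ^ (q / p) * ENNReal.ofReal (lorentzQ n y ^ s) < ∞ :=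
    (ENNReal.rpow_lt_top_iff_of_pos (by positivity : 0 < 1 / q)).1 hfin
  have hHae : ∀ᵐ y ∂(volume.restrict (lightCone n)), H y ≠ ∞ := by
    filter_upwards [ae_lt_top' (aemeasurable_mixedNorm_integrand p q ν holF) hJfin.ne,
      ae_restrict_mem isOpen_lightCone.measurableSet] with y hy hyΛ hHy
    have hw : ENNReal.ofReal (lorentzQ n y ^ s) ≠ 0 := by
      simpa using Real.rpow_pos_of_pos hyΛ.2 s
    change H y ^ (q / p) * _ < ∞ at hy
    rw [hHy, ENNReal.top_rpow_of_pos (by positivity), ENNReal.top_mul hw] at hy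
    exact lt_irrefl _ hy
  set c : ℝ≥0∞ := 2 ^ (p - 1) * 2 with hc
  have hctop : c ≠ ∞ :=
    ENNReal.mul_ne_top (ENNReal.rpow_ne_top_of_nonneg (by linarith) (by simp)) (by simp)
  have hAle : ∀ j, ∀ y ∈ lightCone n, A j y ≤ c * H y := by
    intro j y hy
    have hm : Measurable fun x => ‖F (tubePt n x y)‖ₑ ^ p :=
      (continuous_slice holF hy).measurable.enorm.pow_const p
    calc A j y ≤ ∫⁻ x, 2 ^ (p - 1) *
          (‖F (tubePt n x y)‖ₑ ^ p + ‖G j (tubePt n x y)‖ₑ ^ p) :=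
          lintegral_mono fun x => (ENNReal.rpow_le_rpow enorm_sub_le hp0.le).trans
            (ENNReal.rpow_add_le_mul_rpow_add_rpow _ _ hp)
      _ = 2 ^ (p - 1) * (H y + ∫⁻ x, ‖G j (tubePt n x y)‖ₑ ^ p) := by
          rw [lintegral_const_mul' _ _ (ENNReal.rpow_ne_top_of_nonneg (by linarith) (by simp)),
            lintegral_add_left hm]
      _ ≤ 2 ^ (p - 1) * (H y + H y) := mul_le_mul' le_rfl (add_le_add le_rfl (hle j y hy))
      _ = c * H y := by rw [hc, ← two_mul, mul_assoc]
  have hAlim : ∀ y ∈ lightCone n, H y ≠ ∞ → Tendsto (fun j => A j y) atTop (𝓝 0) :=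
    fun y hy hHy => tendsto_lintegral_rpow_sub_of_lintegral_le hp
      (continuous_slice holF hy).measurable (fun j => (continuous_slice (holG j) hy).measurable)
      (fun x => hlim _ (tubePt_mem_tubeSet.2 hy)) (fun j => hle j y hy) hHy
  have hAm : ∀ j, AEMeasurable (fun y => A j y ^ (q / p) * ENNReal.ofReal (lorentzQ n y ^ s))
      ((volume : Measure (Fin n → ℝ)).restrict (lightCone n)) := fun j =>
    aemeasurable_mixedNorm_integrand (F := fun z => F z - G j z) p q ν (holF.sub (holG j))
  have hmain : Tendsto (fun j => ∫⁻ y in lightCone n,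
      A j y ^ (q / p) * ENNReal.ofReal (lorentzQ n y ^ s)) atTop
      (𝓝 (∫⁻ _ in lightCone n, 0)) := by
    refine tendsto_lintegral_of_dominated_convergence'
      (fun y => c ^ (q / p) * (H y ^ (q / p) * ENNReal.ofReal (lorentzQ n y ^ s)))
      hAm (fun j => ?_) ?_ ?_
    · filter_upwards [ae_restrict_mem isOpen_lightCone.measurableSet] with y hy
      rw [← mul_assoc, ← ENNReal.mul_rpow_of_nonneg _ _ (by positivity)]
      exact mul_le_mul' (ENNReal.rpow_le_rpow (hAle j y hy) (by positivity)) le_rfl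
    · have hctop' : c ^ (q / p) ≠ ∞ := ENNReal.rpow_ne_top_of_nonneg (by positivity) hctop
      rw [lintegral_const_mul' _ _ hctop']
      exact ENNReal.mul_ne_top hctop' hJfin.ne
    · filter_upwards [hHae, ae_restrict_mem isOpen_lightCone.measurableSet] with y hHy hy
      have h1 := (ENNReal.continuous_rpow_const (y := q / p)).tendsto 0 |>.comp (hAlim y hy hHy)
      rw [ENNReal.zero_rpow_of_pos (by positivity)] at h1
      simpa using ENNReal.Tendsto.mul_const h1 (Or.inr ENNReal.ofReal_ne_top)
  rw [lintegral_zero] at hmain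
  have h2 := (ENNReal.continuous_rpow_const (y := 1 / q)).tendsto 0 |>.comp hmain
  rwa [ENNReal.zero_rpow_of_pos (by positivity)] at h2

end MixedNorm

/-- density of `H²(T_{Λ_n}) ∩ A^{p,q}_ν` in `A^{p,q}_ν`. Every
holomorphic `F` with finite mixed norm can be approximated in mixed norm by
holomorphic functions `G` with finite mixed norm that also lie in the Hardy space
`H²(T_{Λ_n})`, i.e. `sup_{y ∈ Λ_n} ∫ |G(x+iy)|² dx < ∞`. -/
theorem statement19 (n : ℕ) [NeZero n] (hn : 3 ≤ n) (ν p q : ℝ)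
    (hν : (n : ℝ) / 2 - 1 < ν) (hp : 1 ≤ p) (hq : 1 ≤ q)
    (F : (Fin n → ℂ) → ℂ)
    (hol : DifferentiableOn ℂ F (tubeSet n))
    (hfin : mixedNorm n p q ν F < ∞)
    (ε : ℝ) (hε : 0 < ε) :
    ∃ G : (Fin n → ℂ) → ℂ,
      DifferentiableOn ℂ G (tubeSet n) ∧
      mixedNorm n p q ν G < ∞ ∧
      (⨆ y ∈ lightCone n, ∫⁻ x : Fin n → ℝ, (‖G (tubePt n x y)‖₊ : ℝ≥0∞) ^ (2 : ℝ)) < ∞ ∧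
      mixedNorm n p q ν (fun z => F z - G z) < ENNReal.ofReal ε := by
  set M := 2 * ⌈|ν - (n : ℝ) / 2|⌉₊ with hM
  set t : ℕ → ℝ := fun j => 1 / ((j : ℝ) + 1) with ht
  have ht0 : ∀ j, 0 < t j := fun j => by positivity
  have ht1 : ∀ j, t j ≤ 1 := fun j => by
    rw [ht, div_le_one (by positivity)]
    linarith [j.cast_nonneg (α := ℝ)]
  have hgrowth := fun {δ : ℝ} (hδ : 0 < δ) => exists_norm_le_mul_pow hp hq hol hfin hδ
  have hG := fun j => differentiableOn_approximant (M + (n + 1)) hol (ht0 j)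
  have hle : ∀ j, ∀ y ∈ lightCone n,
      ∫⁻ x, ‖approximant n (M + (n + 1)) F (t j) (tubePt n x y)‖ₑ ^ p ≤
        ∫⁻ x, ‖F (tubePt n x y)‖ₑ ^ p := by
    intro j y hy
    refine (lintegral_mono fun x => ?_).trans (lintegral_slice_add_smul_eVec_le hp hol
      (fun δ hδ => let ⟨C, hC, h⟩ := hgrowth hδ; ⟨C, M, hC, h⟩) hy (ht0 j).le)
    exact ENNReal.rpow_le_rpow (enorm_le_iff_norm_le.2 (norm_approximant_le _ (ht0 j) hy))
      (by linarith)
  have hlim := tendsto_mixedNorm_sub hp (by linarith) hol hG hfin hle fun z hz =>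
    tendsto_approximant _ hol tendsto_one_div_add_atTop_nhds_zero_nat hz
  obtain ⟨j, hj⟩ := (hlim.eventually_lt_const (ENNReal.ofReal_pos.2 hε)).exists
  obtain ⟨C, hC, hCF⟩ := hgrowth (ht0 j)
  exact ⟨_, hG j, (mixedNorm_mono (by linarith) (by linarith) (hle j)).trans_lt hfin,
    iSup_lintegral_sq_lt_top fun x y hy =>
      norm_approximant_le_mul_inv (n + 1) (ht0 j) (ht1 j) hC hCF hy, hj⟩
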